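/- Let (c_1, ..., c_N) be the quiddity of a 3-periodic dissection of a convex N-gon. Then the product M(c_1)·M(c_2)·...·M(c_N) equals Id or -Id in SL(2,ℤ), where M(c) = [[c, -1],[1, 0]]. -/

import Mathlib

/-! A combinatorial model of dissections of a convex `N`-gon.
Vertices are `Fin N` in cyclic (convex position) order.  A dissection is
recorded by its set of pairwise non-crossing diagonals; its cells are the
faces of the resulting subdivision. -/

namespace PolygonDissection

/-- The cyclic successor of a vertex of the `N`-gon. -/
def cyc {N : ℕ} (i : Fin N) : Fin N := ⟨(i.val + 1) % N, Nat.mod_lt _ i.pos⟩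

/-- `e` is a side of the convex `N`-gon: a pair of cyclically adjacent vertices. -/
def IsSide (N : ℕ) (e : Finset (Fin N)) : Prop :=
  ∃ i : Fin N, i ≠ cyc i ∧ e = {i, cyc i}

/-- `e` is a diagonal of the convex `N`-gon. -/
def IsDiag (N : ℕ) (e : Finset (Fin N)) : Prop :=
  e.card = 2 ∧ ¬ IsSide N e

/-- Two chords of the convex `N`-gon cross in the interior. -/
def Crosses (N : ℕ) (e f : Finset (Fin N)) : Prop :=
  ∃ a b c d : Fin N, a < c ∧ c < b ∧ b < d ∧
    ((e = {a, b} ∧ f = {c, d}) ∨ (e = {c, d} ∧ f = {a, b}))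

/-- A dissection of the convex `N`-gon: a set of pairwise non-crossing diagonals. -/
def IsDissection (N : ℕ) (S : Finset (Finset (Fin N))) : Prop :=
  (∀ e ∈ S, IsDiag N e) ∧ ∀ e ∈ S, ∀ f ∈ S, ¬ Crosses N e f

/-- `y` is the cyclic successor of `x` among the vertices of `c`. -/
def IsNext {N : ℕ} (c : Finset (Fin N)) (x y : Fin N) : Prop :=
  x ∈ c ∧ y ∈ c ∧ y ≠ x ∧ ∀ z ∈ c, z ≠ x → (y - x).val ≤ (z - x).val

/-- `c` (a set of polygon vertices) is a cell of the dissection `S`: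
each pair of cyclically consecutive vertices of `c` is joined by a side of the
polygon or a diagonal of `S`, and no diagonal of `S` is an interior chord of `c`. -/
def IsCell (N : ℕ) (S : Finset (Finset (Fin N))) (c : Finset (Fin N)) : Prop :=
  3 ≤ c.card ∧
  (∀ x y : Fin N, IsNext c x y → IsSide N {x, y} ∨ {x, y} ∈ S) ∧
  (∀ e ∈ S, e ⊆ c → ∃ x y, e = ({x, y} : Finset (Fin N)) ∧ (IsNext c x y ∨ IsNext c y x))

/-- The number of cells of the dissection `S`. -/
noncomputable def numCells (N : ℕ) (S : Finset (Finset (Fin N))) : ℕ :=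
  {c : Finset (Fin N) | IsCell N S c}.ncard

/-- The quiddity of the dissection `S`: its `i`-th entry is the number of
cells containing the `i`-th vertex. -/
noncomputable def quiddity (N : ℕ) (S : Finset (Finset (Fin N))) (i : Fin N) : ℕ :=
  {c : Finset (Fin N) | IsCell N S c ∧ i ∈ c}.ncard

/-- The elementary matrix `M(c) = [[c, -1], [1, 0]]`. -/
def Mmat (c : ℤ) : Matrix (Fin 2) (Fin 2) ℤ := !![c, -1; 1, 0]

theorem exists_pred (c : Finset ℕ) (y : ℕ) (h : ∃ x ∈ c, x < y) :
    ∃ x ∈ c, x < y ∧ ∀ z ∈ c, z < y → z ≤ x := by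
  obtain ⟨x0, hx0, h0⟩ := h
  have hne : (c.filter (· < y)).Nonempty := ⟨x0, by simp [hx0, h0]⟩
  have h1 := Finset.max'_mem _ hne
  rw [Finset.mem_filter] at h1
  exact ⟨_, h1.1, h1.2, fun z hz hzy => Finset.le_max' _ _ (by simp [hz, hzy])⟩

theorem exists_succ (c : Finset ℕ) (y : ℕ) (h : ∃ x ∈ c, y < x) :
    ∃ x ∈ c, y < x ∧ ∀ z ∈ c, y < z → x ≤ z := by
  obtain ⟨x0, hx0, h0⟩ := h
  have hne : (c.filter (y < ·)).Nonempty := ⟨x0, by simp [hx0, h0]⟩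
  have h1 := Finset.min'_mem _ hne
  rw [Finset.mem_filter] at h1
  exact ⟨_, h1.1, h1.2, fun z hz hzy => Finset.min'_le _ _ (by simp [hz, hzy])⟩

def Con (c : Finset ℕ) (x y : ℕ) : Prop :=
  x ∈ c ∧ y ∈ c ∧ x < y ∧ ∀ z ∈ c, ¬ (x < z ∧ z < y)

def Extr (c : Finset ℕ) (x y : ℕ) : Prop :=
  x ∈ c ∧ y ∈ c ∧ x < y ∧ ∀ z ∈ c, x ≤ z ∧ z ≤ y

def LCell (E : ℕ → ℕ → Prop) (d : Finset ℕ) : Prop :=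
  3 ≤ d.card ∧ (∀ x y, Con d x y → E x y) ∧ (∀ x y, Extr d x y → E x y) ∧
  ∀ x ∈ d, ∀ y ∈ d, E x y → Con d x y ∨ Extr d x y

theorem third {d : Finset ℕ} (h : 3 ≤ d.card) (x y : ℕ) : ∃ z ∈ d, z ≠ x ∧ z ≠ y := by
  by_contra hc
  push Not at hc
  have : d ⊆ {x, y} := fun z hz => by
    simp only [Finset.mem_insert, Finset.mem_singleton]
    by_cases hx : z = x
    · exact Or.inl hx
    · exact Or.inr (hc z hz hx)
  have := Finset.card_le_card this
  have := Finset.card_le_two (a := x) (b := y)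
  omega

theorem exists_extr {d : Finset ℕ} (h : 3 ≤ d.card) : ∃ x y, Extr d x y := by
  have hne : d.Nonempty := Finset.card_pos.1 (by omega)
  obtain ⟨z, hz, h1, h2⟩ := third h (d.min' hne) (d.max' hne)
  have a1 := Finset.min'_le d z hz
  have a2 := Finset.le_max' d z hz
  exact ⟨d.min' hne, d.max' hne, Finset.min'_mem _ _, Finset.max'_mem _ _, by omega,
    fun w hw => ⟨Finset.min'_le d w hw, Finset.le_max' d w hw⟩⟩

structure Good (N : ℕ) (E : ℕ → ℕ → Prop) : Prop where
  lt : ∀ u v, E u v → u < v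
  bd : ∀ u v, E u v → v < N
  side : ∀ u, u + 1 < N → E u (u+1)
  nc : ∀ u v p q, E u v → E p q → u < p → p < v → v < q → False

theorem cut {N : ℕ} {E : ℕ → ℕ → Prop} (G : Good N E) {d : Finset ℕ} (hd : LCell E d)
    {u v y : ℕ} (huv : E u v) (hy : y ∈ d) (h1 : u < y) (h2 : y < v) :
    ∀ z ∈ d, u ≤ z ∧ z ≤ v := by
  obtain ⟨hc, hcon, hext, hin⟩ := hd
  intro z hz
  by_contra hne
  obtain ⟨mn, mx, hE⟩ := exists_extr hc
  have hmm := hext _ _ hE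
  obtain ⟨hmn, hmx, hlt, hall⟩ := hE
  have hz' := hall z hz
  have hy' := hall y hy
  by_cases hud : u ∈ d
  · by_cases hvd : v ∈ d
    · rcases hin u hud v hvd huv with h | h
      · exact h.2.2.2 y hy ⟨h1, h2⟩
      · have := h.2.2.2 z hz
        omega
    · by_cases hzv : v < mx
      · obtain ⟨p, hp, hpv, hp'⟩ := exists_pred d v ⟨y, hy, h2⟩
        obtain ⟨q, hq, hqv, hq'⟩ := exists_succ d v ⟨mx, hmx, hzv⟩
        have hpq : E p q := hcon p q ⟨hp, hq, by omega, fun w hw hw2 => by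
          rcases lt_trichotomy w v with h | h | h
          · have := hp' w hw h; omega
          · exact hvd (h ▸ hw)
          · have := hq' w hw h; omega⟩
        have := hp' y hy h2
        exact G.nc u v p q huv hpq (by omega) hpv hqv
      · have : mx ≠ v := fun h => hvd (h ▸ hmx)
        exact G.nc mn mx u v hmm huv (by omega) (by omega) (by omega)
  · by_cases hzu : mn < u
    · obtain ⟨p, hp, hpv, hp'⟩ := exists_pred d u ⟨mn, hmn, hzu⟩
      obtain ⟨q, hq, hqv, hq'⟩ := exists_succ d u ⟨y, hy, h1⟩
      have hpq : E p q := hcon p q ⟨hp, hq, by omega, fun w hw hw2 => by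
        rcases lt_trichotomy w u with h | h | h
        · have := hp' w hw h; omega
        · exact hud (h ▸ hw)
        · have := hq' w hw h; omega⟩
      have := hq' y hy h1
      exact G.nc p q u v hpq huv (by omega) (by omega) (by omega)
    · have : mn ≠ u := fun h => hud (h ▸ hmn)
      exact G.nc u v mn mx huv hmm (by omega) (by omega) (by omega)

/-- existence of the top cell of an interval, with its properties -/
theorem topcell {N : ℕ} {E : ℕ → ℕ → Prop} (G : Good N E) {a b : ℕ} (hab : E a b)
    (h2 : a + 2 ≤ b) : ∃ c : Finset ℕ, LCell E c ∧ Extr c a b ∧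
      (∀ x y, Con c x y → ¬ (x = a ∧ y = b)) ∧
      ∀ d, LCell E d → (∀ z ∈ d, a ≤ z ∧ z ≤ b) → d ≠ c →
        ∃ u v, Con c u v ∧ ∀ z ∈ d, u ≤ z ∧ z ≤ v := by
  classical
  have hbN := G.bd _ _ hab
  let c := (Finset.range (b+1)).filter (fun x => a ≤ x ∧ ∀ u v, E u v → a ≤ u → v ≤ b →
    u < x → x < v → (u = a ∧ v = b))
  have hmem : ∀ x, x ∈ c ↔ (a ≤ x ∧ x ≤ b ∧ ∀ u v, E u v → a ≤ u → v ≤ b →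
    u < x → x < v → (u = a ∧ v = b)) := by
    intro x
    simp only [c, Finset.mem_filter, Finset.mem_range, Nat.lt_succ_iff]
    tauto
  have ha : a ∈ c := (hmem a).2 ⟨le_rfl, by omega, fun u v _ _ _ _ _ => by omega⟩
  have hb : b ∈ c := (hmem b).2 ⟨by omega, le_rfl, fun u v _ _ _ _ _ => by omega⟩
  have hcon : ∀ x y, Con c x y → E x y ∧ ¬ (x = a ∧ y = b) := by
    rintro x y ⟨hx, hy, hxy, hno⟩
    have hx' := (hmem x).1 hx
    have hy' := (hmem y).1 hy
    let F := (Finset.range (b+1)).filter (fun v => E x v ∧ ¬ (x = a ∧ v = b))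
    have hFm : ∀ v, v ∈ F ↔ (v ≤ b ∧ E x v ∧ ¬ (x = a ∧ v = b)) := by
      intro v; simp only [F, Finset.mem_filter, Finset.mem_range, Nat.lt_succ_iff]
    have hF : F.Nonempty := ⟨x+1, (hFm _).2 ⟨by omega, G.side x (by omega), by omega⟩⟩
    obtain ⟨v, hv, hvm⟩ : ∃ v ∈ F, ∀ w ∈ F, w ≤ v :=
      ⟨F.max' hF, F.max'_mem hF, fun w hw => F.le_max' w hw⟩
    obtain ⟨hvb, hxv, hvn⟩ := (hFm v).1 hv
    have hlt := G.lt _ _ hxv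
    have hvc : v ∈ c := by
      refine (hmem v).2 ⟨by omega, hvb, fun p q hpq hap hqb hpv hvq => ?_⟩
      by_contra hn
      rcases lt_trichotomy p x with h | h | h
      · exact hn (hx'.2.2 p q hpq hap hqb h (by omega))
      · subst h
        have := hvm q ((hFm q).2 ⟨hqb, hpq, hn⟩)
        omega
      · exact G.nc x v p q hxv hpq h hpv hvq
    have h1 := hno v hvc
    have : v = y := by
      by_contra hne
      exact hvn (hy'.2.2 x v hxv hx'.1 hvb hxy (by omega))
    subst this
    exact ⟨hxv, hvn⟩
  have hext : Extr c a b := ⟨ha, hb, by omega, fun z hz => ⟨((hmem z).1 hz).1, ((hmem z).1 hz).2.1⟩⟩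
  have hthird : ∃ z ∈ c, a < z ∧ z < b := by
    by_contra hn
    push Not at hn
    exact (hcon a b ⟨ha, hb, by omega, fun z hz hz2 => by have := hn z hz hz2.1; omega⟩).2 ⟨rfl, rfl⟩
  have hcell : LCell E c := by
    refine ⟨?_, fun x y h => (hcon x y h).1, ?_, ?_⟩
    · obtain ⟨z, hz, h1, h2⟩ := hthird
      have : ({a, z, b} : Finset ℕ) ⊆ c := by
        intro w hw
        simp only [Finset.mem_insert, Finset.mem_singleton] at hw
        rcases hw with rfl | rfl | rfl <;> assumption
      have h3 := Finset.card_le_card this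
      rw [Finset.card_eq_three.2 ⟨a, z, b, by omega, by omega, by omega, rfl⟩] at h3
      exact h3
    · rintro x y ⟨hx, hy, hxy, hall⟩
      have h1 := hall a ha
      have h2 := hall b hb
      have h3 := hext.2.2.2 x hx
      have h4 := hext.2.2.2 y hy
      have e1 : x = a := by omega
      have e2 : y = b := by omega
      rw [e1, e2]; exact hab
    · intro x hx y hy hxy
      by_cases h : ∃ z ∈ c, x < z ∧ z < y
      · obtain ⟨z, hz, h1, h2⟩ := h
        obtain ⟨rfl, rfl⟩ := ((hmem z).1 hz).2.2 x y hxy (hext.2.2.2 x hx).1 (hext.2.2.2 y hy).2 h1 h2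
        exact Or.inr hext
      · push Not at h
        exact Or.inl ⟨hx, hy, G.lt _ _ hxy, fun z hz hz2 => by have := h z hz hz2.1; omega⟩
  refine ⟨c, hcell, hext, fun x y h => (hcon x y h).2, ?_⟩
  intro d hd hdab hdc
  by_cases hsub : d ⊆ c
  · exfalso
    apply hdc
    obtain ⟨mn, mx, hE⟩ := exists_extr hd.1
    have hmm := hd.2.2.1 _ _ hE
    obtain ⟨z, hz, hz1, hz2⟩ := third hd.1 mn mx
    have hz3 := hE.2.2.2 z hz
    have hq := ((hmem z).1 (hsub hz)).2.2 mn mx hmm (hdab _ hE.1).1 (hdab _ hE.2.1).2 (by omega) (by omega)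
    obtain ⟨rfl, rfl⟩ := hq
    refine Finset.Subset.antisymm hsub fun y hy => ?_
    by_contra hyd
    have hy1 := hext.2.2.2 y hy
    have : y ≠ mn := fun h => hyd (h ▸ hE.1)
    have : y ≠ mx := fun h => hyd (h ▸ hE.2.1)
    obtain ⟨p, hp, hpv, hp'⟩ := exists_pred d y ⟨mn, hE.1, by omega⟩
    obtain ⟨q, hq, hqv, hq'⟩ := exists_succ d y ⟨mx, hE.2.1, by omega⟩
    have hpq : E p q := hd.2.1 p q ⟨hp, hq, by omega, fun w hw hw2 => by
        rcases lt_trichotomy w y with h | h | h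
        · have := hp' w hw h; omega
        · exact hyd (h ▸ hw)
        · have := hq' w hw h; omega⟩
    have h7 := ((hmem y).1 hy).2.2 p q hpq (hdab p hp).1 (hdab q hq).2 hpv hqv
    rcases lt_trichotomy z y with h | h | h
    · have := hp' z hz h; omega
    · exact hyd (h ▸ hz)
    · have := hq' z hz h; omega
  · obtain ⟨y, hyd, hyc⟩ := Finset.not_subset.1 hsub
    have hy1 := hdab y hyd
    have : y ≠ a := fun h => hyc (h ▸ ha)
    have : y ≠ b := fun h => hyc (h ▸ hb)
    obtain ⟨p, hp, hpv, hp'⟩ := exists_pred c y ⟨a, ha, by omega⟩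
    obtain ⟨q, hq, hqv, hq'⟩ := exists_succ c y ⟨b, hb, by omega⟩
    have hpq : Con c p q := ⟨hp, hq, by omega, fun w hw hw2 => by
        rcases lt_trichotomy w y with h | h | h
        · have := hp' w hw h; omega
        · exact hyc (h ▸ hw)
        · have := hq' w hw h; omega⟩
    exact ⟨p, q, hpq, cut G hd (hcon p q hpq).1 hyd hpv hqv⟩

def Tm (n : ℕ) : Matrix (Fin 2) (Fin 2) ℤ := !![1, n; 0, 1]
def Jm : Matrix (Fin 2) (Fin 2) ℤ := !![0, -1; 1, 0]

theorem Tm_add (m n : ℕ) : Tm (m + n) = Tm m * Tm n := by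
  simp [Tm, add_comm]

theorem Tm_zero : Tm 0 = 1 := by
  ext i j; fin_cases i <;> fin_cases j <;> simp [Tm]

theorem Mmat_eq (n : ℕ) : Mmat n = Tm n * Jm := by
  simp [Tm, Mmat, Jm]

theorem TJ3 : (Tm 1 * Jm) ^ 3 = -1 := by
  ext i j; fin_cases i <;> fin_cases j <;> simp [Tm, Jm, pow_succ]

def PM (A B : Matrix (Fin 2) (Fin 2) ℤ) : Prop := A = B ∨ A = -B

theorem PM.mul {A B C D : Matrix (Fin 2) (Fin 2) ℤ} (h : PM A B) (h' : PM C D) :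
    PM (A * C) (B * D) := by
  rcases h with rfl | rfl <;> rcases h' with rfl | rfl <;> simp [PM]

theorem PM.refl (A : Matrix (Fin 2) (Fin 2) ℤ) : PM A A := Or.inl rfl

theorem PM.trans {A B C : Matrix (Fin 2) (Fin 2) ℤ} (h : PM A B) (h' : PM B C) : PM A C := by
  rcases h with rfl | rfl <;> rcases h' with rfl | rfl <;> simp [PM]

def Pr (f : ℕ → ℕ) (a : ℕ) : ℕ → Matrix (Fin 2) (Fin 2) ℤ
  | 0 => 1
  | n + 1 => Pr f a n * Mmat (f (a + n))

theorem Pr_add (f : ℕ → ℕ) (a m n : ℕ) : Pr f a (m + n) = Pr f a m * Pr f (a + m) n := by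
  induction n with
  | zero => simp [Pr]
  | succ n ih => rw [← add_assoc, Pr, Pr, ih, mul_assoc, add_assoc]

theorem Pr_congr {f g : ℕ → ℕ} {a n : ℕ} (h : ∀ i, a ≤ i → i < a + n → f i = g i) :
    Pr f a n = Pr g a n := by
  induction n with
  | zero => rfl
  | succ n ih =>
    rw [Pr, Pr, ih (fun i h1 h2 => h i h1 (by omega)), h (a + n) (by omega) (by omega)]

theorem Pr_first (f : ℕ → ℕ) (a n : ℕ) : Pr f a (n + 1) = Mmat (f a) * Pr f (a + 1) n := by
  rw [add_comm, Pr_add]; simp [Pr]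

noncomputable def qd (E : ℕ → ℕ → Prop) (a b i : ℕ) : ℕ :=
  {d : Finset ℕ | LCell E d ∧ i ∈ d ∧ ∀ z ∈ d, a ≤ z ∧ z ≤ b}.ncard

theorem fin_le (b : ℕ) (s : Set (Finset ℕ)) (h : ∀ d ∈ s, ∀ z ∈ d, z ≤ b) : s.Finite := by
  refine (Finset.finite_toSet (Finset.range (b+1)).powerset).subset fun d hd => ?_
  simp only [Finset.coe_powerset, Set.mem_preimage, Set.mem_powerset_iff, Finset.coe_subset]
  intro z hz
  have := h d hd z hz
  simp; omega

noncomputable def Lq (E : ℕ → ℕ → Prop) (c : Finset ℕ) (a m : ℕ) : ℕ :=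
  {d : Finset ℕ | LCell E d ∧ d ≠ c ∧ m ∈ d ∧ ∀ z ∈ d, a ≤ z ∧ z ≤ m}.ncard

theorem small {E : ℕ → ℕ → Prop} {d : Finset ℕ} (hd : LCell E d) {x y : ℕ}
    (h : ∀ z ∈ d, z = x ∨ z = y) : False := by
  obtain ⟨z, hz, h1, h2⟩ := third hd.1 x y
  rcases h z hz with h | h <;> contradiction

theorem main {N : ℕ} {E : ℕ → ℕ → Prop} (G : Good N E)
    (h3 : ∀ d, LCell E d → d.card % 3 = 0) (n : ℕ) : ∀ a b, b - a = n → E a b →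
    PM (Pr (qd E a b) a (b - a) * Tm (qd E a b b)) Jm := by
  induction n using Nat.strong_induction_on with
  | _ n IH =>
  intro a b hn hab
  have hlt := G.lt _ _ hab
  by_cases hbase : b = a + 1
  · subst hbase
    have h0 : ∀ i, qd E a (a+1) i = 0 := by
      intro i
      have : {d : Finset ℕ | LCell E d ∧ i ∈ d ∧ ∀ z ∈ d, a ≤ z ∧ z ≤ a+1} = ∅ := by
        ext d
        simp only [Set.mem_ofPred_eq, Set.mem_empty_iff_false, iff_false]
        rintro ⟨h1, h2, h3⟩
        exact small h1 (x := a) (y := a+1) (fun z hz => by have := h3 z hz; omega)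
      rw [qd, this, Set.ncard_empty]
    have e : a + 1 - a = 0 + 1 := by omega
    rw [h0, e, Pr, Pr, h0, Mmat_eq, Tm_zero]
    simp [PM]
  obtain ⟨c, hc, hext, hne, hkey⟩ := topcell G hab (by omega)
  obtain ⟨hac, hbc, -, hcab⟩ := hext
  have hL0 : Lq E c a a = 0 := by
    have : {d : Finset ℕ | LCell E d ∧ d ≠ c ∧ a ∈ d ∧ ∀ z ∈ d, a ≤ z ∧ z ≤ a} = ∅ := by
      ext d
      simp only [Set.mem_ofPred_eq, Set.mem_empty_iff_false, iff_false]
      rintro ⟨h1, -, h2, h3⟩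
      exact small h1 (x := a) (y := a) (fun z hz => by have := h3 z hz; omega)
    rw [Lq, this, Set.ncard_empty]
  -- a piece is never `c`
  have hpiece : ∀ u v, Con c u v → ∀ d, LCell E d → (∀ z ∈ d, u ≤ z ∧ z ≤ v) → d ≠ c := by
    rintro u v huv d hd hd2 rfl
    have h1 := hd2 a hac
    have h2 := hd2 b hbc
    have h3 := hcab u huv.1
    have h4 := hcab v huv.2.1
    exact hne u v huv ⟨by omega, by omega⟩
  have hL : ∀ u v, Con c u v → Lq E c a v = qd E u v v := by
    intro u v huv
    rw [Lq, qd]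
    congr 1
    ext d
    simp only [Set.mem_ofPred_eq]
    constructor
    · rintro ⟨h1, h2, h3, h4⟩
      refine ⟨h1, h3, ?_⟩
      have hv := hcab v huv.2.1
      obtain ⟨p, q, hpq, hd⟩ := hkey d h1 (fun z hz => by have := h4 z hz; omega) h2
      have hvd := hd v h3
      intro z hz
      have hz1 := h4 z hz
      have hz2 := hd z hz
      refine ⟨?_, hz1.2⟩
      -- p < v, so p ≤ u?  need `u ≤ p`
      have hpv : p ≠ v := by
        rintro rfl
        exact small h1 (x := p) (y := p) (fun w hw => by
          have := hd w hw; have := h4 w hw; omega)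
      by_contra hlt2
      exact hpq.2.2.2 u huv.1 ⟨by omega, by have := huv.2.2.1; omega⟩
    · rintro ⟨h1, h2, h3⟩
      refine ⟨h1, hpiece u v huv d h1 h3, h2, fun z hz => ?_⟩
      have := h3 z hz
      have := hcab u huv.1
      omega
  have hmid : ∀ u v, Con c u v → ∀ x, u < x → x < v → qd E a b x = qd E u v x := by
    intro u v huv x h1 h2
    rw [qd, qd]
    congr 1
    ext d
    simp only [Set.mem_ofPred_eq]
    have hu := hcab u huv.1
    have hv := hcab v huv.2.1
    constructor
    · rintro ⟨h3, h4, h5⟩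
      exact ⟨h3, h4, cut G h3 (hc.2.1 u v huv) h4 h1 h2⟩
    · rintro ⟨h3, h4, h5⟩
      exact ⟨h3, h4, fun z hz => by have := h5 z hz; omega⟩
  have hnode : ∀ u v, Con c u v → qd E a b u = Lq E c a u + 1 + qd E u v u := by
    intro u v huv
    have hu := hcab u huv.1
    have hv := hcab v huv.2.1
    have huv' := huv.2.2.1
    have hset : {d : Finset ℕ | LCell E d ∧ u ∈ d ∧ ∀ z ∈ d, a ≤ z ∧ z ≤ b} =
      insert c ({d : Finset ℕ | LCell E d ∧ d ≠ c ∧ u ∈ d ∧ ∀ z ∈ d, a ≤ z ∧ z ≤ u} ∪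
        {d : Finset ℕ | LCell E d ∧ u ∈ d ∧ ∀ z ∈ d, u ≤ z ∧ z ≤ v}) := by
      ext d
      simp only [Set.mem_ofPred_eq, Set.mem_insert_iff, Set.mem_union]
      constructor
      · rintro ⟨h1, h2, h3⟩
        by_cases hdc : d = c
        · exact Or.inl hdc
        right
        obtain ⟨p, q, hpq, hd⟩ := hkey d h1 h3 hdc
        have hud := hd u h2
        by_cases hqu : q = u
        · left
          exact ⟨h1, hdc, h2, fun z hz => by have := hd z hz; have := h3 z hz; omega⟩
        · right
          have hpu : p = u := by
            by_contra hpu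
            exact hpq.2.2.2 u huv.1 ⟨by omega, by omega⟩
          subst hpu
          have hqv : q ≤ v := by
            by_contra hqv
            exact hpq.2.2.2 v huv.2.1 ⟨by omega, by omega⟩
          exact ⟨h1, h2, fun z hz => by have := hd z hz; omega⟩
      · rintro (rfl | ⟨h1, h2, h3, h4⟩ | ⟨h1, h2, h3⟩)
        · exact ⟨hc, huv.1, hcab⟩
        · exact ⟨h1, h3, fun z hz => by have := h4 z hz; omega⟩
        · exact ⟨h1, h2, fun z hz => by have := h3 z hz; omega⟩
    have f1 : {d : Finset ℕ | LCell E d ∧ d ≠ c ∧ u ∈ d ∧ ∀ z ∈ d, a ≤ z ∧ z ≤ u}.Finite :=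
      fin_le u _ (fun d hd z hz => (hd.2.2.2 z hz).2)
    have f2 : {d : Finset ℕ | LCell E d ∧ u ∈ d ∧ ∀ z ∈ d, u ≤ z ∧ z ≤ v}.Finite :=
      fin_le v _ (fun d hd z hz => (hd.2.2 z hz).2)
    rw [qd, hset, Set.ncard_insert_of_notMem _ (f1.union f2), Set.ncard_union_eq _ f1 f2]
    · rw [Lq, qd]; ring
    · rw [Set.disjoint_left]
      rintro d ⟨h1, h2, h3, h4⟩ ⟨h5, h6, h7⟩
      exact small h1 (x := u) (y := u) (fun w hw => by
          have := h4 w hw; have := h7 w hw; omega)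
    · rintro (⟨h1, h2, h3, h4⟩ | ⟨h1, h2, h3⟩)
      · exact h2 rfl
      · exact hpiece u v huv c h1 h3 rfl
  have hlast : qd E a b b = Lq E c a b + 1 := by
    have hset : {d : Finset ℕ | LCell E d ∧ b ∈ d ∧ ∀ z ∈ d, a ≤ z ∧ z ≤ b} =
      insert c {d : Finset ℕ | LCell E d ∧ d ≠ c ∧ b ∈ d ∧ ∀ z ∈ d, a ≤ z ∧ z ≤ b} := by
      ext d
      simp only [Set.mem_ofPred_eq, Set.mem_insert_iff]
      constructor
      · rintro ⟨h1, h2, h3⟩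
        by_cases hdc : d = c
        · exact Or.inl hdc
        · exact Or.inr ⟨h1, hdc, h2, h3⟩
      · rintro (rfl | ⟨h1, h2, h3, h4⟩)
        · exact ⟨hc, hbc, hcab⟩
        · exact ⟨h1, h3, h4⟩
    rw [qd, hset, Set.ncard_insert_of_notMem _ (fin_le b _ (fun d hd z hz => (hd.2.2.2 z hz).2))]
    · rfl
    · rintro ⟨h1, h2, h3, h4⟩
      exact h2 rfl
  have hstep : ∀ m, m ∈ c → PM (Pr (qd E a b) a (m - a) * Tm (Lq E c a m))
      ((Tm 1 * Jm) ^ (c.filter (· < m)).card) := by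
    intro m
    induction m using Nat.strong_induction_on with
    | _ v IH2 =>
    intro hv
    have hvab := hcab v hv
    by_cases hva : v = a
    · subst hva
      have : c.filter (· < v) = ∅ := by
        ext z
        simp only [Finset.mem_filter, Finset.notMem_empty, iff_false]
        rintro ⟨hz, h⟩
        have := hcab z hz
        omega
      rw [hL0, this, Tm_zero]
      simp [Pr, PM]
    obtain ⟨u, hu, huv, hmax⟩ := exists_pred c v ⟨a, hac, by omega⟩
    have hcon : Con c u v := ⟨hu, hv, huv, fun z hz h => by have := hmax z hz h.2; omega⟩
    have hun := hne u v hcon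
    have huab := hcab u hu
    have ihp := IH (v - u) (by omega) u v rfl (hc.2.1 u v hcon)
    have ih2 := IH2 u huv hu
    have hcard : (c.filter (· < v)).card = (c.filter (· < u)).card + 1 := by
      rw [← Finset.card_insert_of_notMem (a := u) (s := c.filter (· < u)) (by simp)]
      congr 1
      ext z
      simp only [Finset.mem_filter, Finset.mem_insert]
      constructor
      · rintro ⟨hz, h⟩
        have := hmax z hz h
        by_cases e : z = u
        · exact Or.inl e
        · exact Or.inr ⟨hz, by omega⟩
      · rintro (rfl | ⟨hz, h⟩)
        · exact ⟨hu, huv⟩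
        · exact ⟨hz, by omega⟩
    obtain ⟨k, hk⟩ : ∃ k, v - u = k + 1 := ⟨v - u - 1, by omega⟩
    have e1 : v - a = (u - a) + (k + 1) := by omega
    have e2 : a + (u - a) = u := by omega
    rw [hk, Pr_first] at ihp
    have hcg : Pr (qd E a b) (u+1) k = Pr (qd E u v) (u+1) k :=
      Pr_congr (fun i h1 h2 => hmid u v hcon i (by omega) (by omega))
    rw [e1, Pr_add, e2, Pr_first, hcg, hL u v hcon, hnode u v hcon, hcard, Mmat_eq, Tm_add, Tm_add]
    rw [Mmat_eq] at ihp
    have := (ih2.mul (PM.refl (Tm 1))).mul ihp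
    rw [pow_succ]
    simpa only [mul_assoc] using this
  have hfin := hstep b hbc
  have hcardb : (c.filter (· < b)).card + 1 = c.card := by
    rw [← Finset.card_insert_of_notMem (a := b) (s := c.filter (· < b)) (by simp)]
    congr 1
    ext z
    simp only [Finset.mem_filter, Finset.mem_insert]
    constructor
    · rintro (rfl | ⟨hz, h⟩)
      · exact hbc
      · exact hz
    · intro hz
      have := hcab z hz
      by_cases e : z = b
      · exact Or.inl e
      · exact Or.inr ⟨hz, by omega⟩
  have h1 : PM ((Tm 1 * Jm) ^ c.card) 1 := by
    obtain ⟨k, hk⟩ : ∃ k, c.card = 3 * k := ⟨c.card / 3, by have := h3 c hc; omega⟩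
    rw [hk, pow_mul, TJ3]
    exact neg_one_pow_eq_or _ k
  rw [← hcardb, pow_succ] at h1
  have hJ : Jm * Jm = -1 := by
    ext i j; fin_cases i <;> fin_cases j <;> simp [Jm]
  have h2 : PM ((Tm 1 * Jm) ^ (c.filter (· < b)).card * Tm 1) Jm := by
    have h4 := h1.mul (PM.refl Jm)
    rw [mul_assoc, mul_assoc, hJ, one_mul] at h4
    rcases h4 with h | h
    · right
      rw [mul_neg, mul_one, mul_neg] at h
      exact neg_eq_iff_eq_neg.1 h
    · left; simp only [mul_neg, mul_one, neg_inj] at h; exact h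
  rw [hlast, Tm_add, ← mul_assoc]
  exact (hfin.mul (PM.refl _)).trans h2

def EE (N : ℕ) (S : Finset (Finset (Fin N))) (u v : ℕ) : Prop :=
  u < v ∧ v < N ∧ (v = u + 1 ∨ (u = 0 ∧ v + 1 = N) ∨
    ∃ x y : Fin N, x.val = u ∧ y.val = v ∧ ({x, y} : Finset (Fin N)) ∈ S)

theorem pair_eq {N : ℕ} {x y z w : Fin N} (h : ({x, y} : Finset (Fin N)) = {z, w}) :
    (x = z ∧ y = w) ∨ (x = w ∧ y = z) := by
  have h' : s(x, y) = s(z, w) := by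
    have := congrArg (fun s : Finset (Fin N) => (s : Set (Fin N))) h
    simp only [Finset.coe_insert, Finset.coe_singleton] at this
    rw [Set.pair_eq_pair_iff] at this
    rw [Sym2.eq_iff]; exact this
  exact Sym2.eq_iff.1 h'

theorem side_iff {N : ℕ} (x y : Fin N) (h : x < y) :
    IsSide N {x, y} ↔ (y.val = x.val + 1 ∨ (x.val = 0 ∧ y.val + 1 = N)) := by
  have hy := y.2
  have hxy : x.val < y.val := h
  constructor
  · rintro ⟨i, hi, he⟩
    have hi2 := i.2
    have hc : (cyc i).val = (i.val + 1) % N := rfl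
    have : (i.val + 1 < N ∧ (cyc i).val = i.val + 1) ∨ (i.val + 1 = N ∧ (cyc i).val = 0) := by
      by_cases h1 : i.val + 1 < N
      · left; exact ⟨h1, by rw [hc, Nat.mod_eq_of_lt h1]⟩
      · right
        have : i.val + 1 = N := by omega
        exact ⟨this, by rw [hc, this, Nat.mod_self]⟩
    rcases pair_eq he with ⟨h1, h2⟩ | ⟨h1, h2⟩ <;> subst h1 <;> rw [Fin.ext_iff] at h2 <;> omega
  · rintro (h1 | ⟨h1, h2⟩)
    · have : cyc x = y := Fin.ext (by
        change (x.val + 1) % N = y.val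
        rw [Nat.mod_eq_of_lt (by omega), h1])
      exact ⟨x, by rw [this]; exact h.ne, by rw [this]⟩
    · have : cyc y = x := Fin.ext (by
        change (y.val + 1) % N = x.val
        rw [h2, Nat.mod_self, h1])
      exact ⟨y, by rw [this]; exact h.ne', by rw [this, Finset.pair_comm]⟩

theorem EE_iff {N : ℕ} {S : Finset (Finset (Fin N))} (x y : Fin N) (h : x < y) :
    EE N S x y ↔ (IsSide N {x, y} ∨ {x, y} ∈ S) := by
  rw [side_iff x y h, EE]
  have hy := y.2
  have hxy : x.val < y.val := h
  constructor
  · rintro ⟨-, -, h1 | h1 | ⟨x', y', hx, hy, h1⟩⟩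
    · exact Or.inl (Or.inl h1)
    · exact Or.inl (Or.inr h1)
    · rw [Fin.ext hx, Fin.ext hy] at h1
      exact Or.inr h1
  · rintro ((h1 | h1) | h1)
    · exact ⟨hxy, hy, Or.inl h1⟩
    · exact ⟨hxy, hy, Or.inr (Or.inl h1)⟩
    · exact ⟨hxy, hy, Or.inr (Or.inr ⟨x, y, rfl, rfl, h1⟩)⟩

theorem EE_good {N : ℕ} {S : Finset (Finset (Fin N))} (hS : IsDissection N S) :
    Good N (EE N S) := by
  refine ⟨fun u v h => h.1, fun u v h => h.2.1, fun u h => ⟨by omega, h, Or.inl rfl⟩, ?_⟩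
  rintro u v p q ⟨h1, h2, h3⟩ ⟨h4, h5, h6⟩ h7 h8 h9
  rcases h3 with h3 | h3 | ⟨x, y, rfl, rfl, h3⟩
  · omega
  · omega
  rcases h6 with h6 | h6 | ⟨z, w, rfl, rfl, h6⟩
  · omega
  · omega
  exact hS.2 _ h3 _ h6 ⟨x, y, z, w, h7, h8, h9, Or.inl ⟨rfl, rfl⟩⟩

theorem val_sub' {N : ℕ} (x y : Fin N) :
    (x ≤ y ∧ (y - x).val = y.val - x.val) ∨ (y < x ∧ (y - x).val = N + y.val - x.val) := by
  rcases le_or_gt x y with h | h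
  · exact Or.inl ⟨h, Fin.sub_val_of_le h⟩
  · right
    refine ⟨h, ?_⟩
    have h' : y.val < x.val := h
    have := x.2
    rw [Fin.val_sub, Nat.mod_eq_of_lt (by omega)]
    omega

def mp {N : ℕ} (c : Finset (Fin N)) : Finset ℕ := c.map Fin.valEmbedding

theorem mem_mp {N : ℕ} {c : Finset (Fin N)} (x : Fin N) : x.val ∈ mp c ↔ x ∈ c := by
  simp only [mp, Finset.mem_map, Fin.valEmbedding_apply]
  constructor
  · rintro ⟨y, hy, h⟩
    rwa [← Fin.ext h]
  · exact fun h => ⟨x, h, rfl⟩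

theorem of_mem_mp {N : ℕ} {c : Finset (Fin N)} {u : ℕ} (h : u ∈ mp c) :
    ∃ x : Fin N, x ∈ c ∧ x.val = u := by
  simpa [mp] using h

theorem next_iff {N : ℕ} (c : Finset (Fin N)) (x y : Fin N) :
    IsNext c x y ↔ Con (mp c) x y ∨ Extr (mp c) y x := by
  constructor
  · rintro ⟨hx, hy, hne, hall⟩
    rcases lt_or_gt_of_ne hne with h | h
    · right
      have h' : y.val < x.val := h
      refine ⟨(mem_mp _).2 hy, (mem_mp _).2 hx, h, fun z hz => ?_⟩
      obtain ⟨z, hzc, rfl⟩ := of_mem_mp hz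
      by_cases hzx : z = x
      · subst hzx; omega
      have hzx' : z.val ≠ x.val := fun h => hzx (Fin.ext h)
      have h1 := hall z hzc hzx
      have hx2 := x.2
      have hy2 := y.2
      have hz2 := z.2
      rcases val_sub' x y with ⟨a1, a2⟩ | ⟨a1, a2⟩ <;> rcases val_sub' x z with ⟨a3, a4⟩ | ⟨a3, a4⟩ <;>
      simp only [Fin.le_def, Fin.lt_def] at a1 a3 <;> omega
    · left
      have h' : x.val < y.val := h
      refine ⟨(mem_mp _).2 hx, (mem_mp _).2 hy, h, fun z hz => ?_⟩
      obtain ⟨z, hzc, rfl⟩ := of_mem_mp hz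
      rintro ⟨b1, b2⟩
      have h1 := hall z hzc (fun h => by rw [h] at b1; omega)
      have hx2 := x.2
      have hy2 := y.2
      have hz2 := z.2
      rcases val_sub' x y with ⟨a1, a2⟩ | ⟨a1, a2⟩ <;> rcases val_sub' x z with ⟨a3, a4⟩ | ⟨a3, a4⟩ <;>
      simp only [Fin.le_def, Fin.lt_def] at a1 a3 <;> omega
  · rintro (⟨hx, hy, h, hall⟩ | ⟨hy, hx, h, hall⟩)
    · refine ⟨(mem_mp _).1 hx, (mem_mp _).1 hy, fun e => by rw [e] at h; omega, fun z hz hzx => ?_⟩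
      have h1 := hall z ((mem_mp _).2 hz)
      have hzx' : z.val ≠ x.val := fun h => hzx (Fin.ext h)
      have hx2 := x.2
      have hy2 := y.2
      have hz2 := z.2
      rcases val_sub' x y with ⟨a1, a2⟩ | ⟨a1, a2⟩ <;> rcases val_sub' x z with ⟨a3, a4⟩ | ⟨a3, a4⟩ <;>
      simp only [Fin.le_def, Fin.lt_def] at a1 a3 <;> omega
    · refine ⟨(mem_mp _).1 hx, (mem_mp _).1 hy, fun e => by rw [e] at h; omega, fun z hz hzx => ?_⟩
      have h1 := hall z ((mem_mp _).2 hz)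
      have hzx' : z.val ≠ x.val := fun h => hzx (Fin.ext h)
      have hx2 := x.2
      have hy2 := y.2
      have hz2 := z.2
      rcases val_sub' x y with ⟨a1, a2⟩ | ⟨a1, a2⟩ <;> rcases val_sub' x z with ⟨a3, a4⟩ | ⟨a3, a4⟩ <;>
      simp only [Fin.le_def, Fin.lt_def] at a1 a3 <;> omega

theorem cell_iff {N : ℕ} {S : Finset (Finset (Fin N))} (hS : IsDissection N S)
    (c : Finset (Fin N)) : IsCell N S c ↔ LCell (EE N S) (mp c) := by
  have hcard : (mp c).card = c.card := Finset.card_map _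
  constructor
  · rintro ⟨h1, h2, h3⟩
    refine ⟨by rw [hcard]; exact h1, ?_, ?_, ?_⟩
    · intro u v h
      obtain ⟨x, hx, rfl⟩ := of_mem_mp h.1
      obtain ⟨y, hy, rfl⟩ := of_mem_mp h.2.1
      exact (EE_iff x y h.2.2.1).2 (h2 x y ((next_iff c x y).2 (Or.inl h)))
    · intro u v h
      obtain ⟨x, hx, rfl⟩ := of_mem_mp h.1
      obtain ⟨y, hy, rfl⟩ := of_mem_mp h.2.1
      have := h2 y x ((next_iff c y x).2 (Or.inr h))
      rw [Finset.pair_comm] at this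
      exact (EE_iff x y h.2.2.1).2 this
    · intro u hu v hv h
      obtain ⟨h4, h5, h6⟩ := h
      rcases h6 with h6 | h6 | ⟨x, y, rfl, rfl, h6⟩
      · exact Or.inl ⟨hu, hv, h4, fun z hz h => by omega⟩
      · refine Or.inr ⟨hu, hv, h4, fun z hz => ?_⟩
        obtain ⟨z, hzc, rfl⟩ := of_mem_mp hz
        have := z.2
        omega
      · have hsub : ({x, y} : Finset (Fin N)) ⊆ c := by
          intro z hz
          simp only [Finset.mem_insert, Finset.mem_singleton] at hz
          rcases hz with rfl | rfl
          · exact (mem_mp _).1 hu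
          · exact (mem_mp _).1 hv
        obtain ⟨p, q, he, hn⟩ := h3 _ h6 hsub
        have hn' : IsNext c x y ∨ IsNext c y x := by
          rcases pair_eq he with ⟨rfl, rfl⟩ | ⟨rfl, rfl⟩
          · exact hn
          · exact hn.symm
        rw [next_iff, next_iff] at hn'
        rcases hn' with (h | h) | (h | h)
        · exact Or.inl h
        · have := h.2.2.1; omega
        · have := h.2.2.1; omega
        · exact Or.inr h
  · rintro ⟨h1, h2, h3, h4⟩
    refine ⟨by rw [← hcard]; exact h1, ?_, ?_⟩
    · intro x y h
      rcases (next_iff c x y).1 h with h | h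
      · exact (EE_iff x y h.2.2.1).1 (h2 _ _ h)
      · rw [Finset.pair_comm]
        exact (EE_iff y x h.2.2.1).1 (h3 _ _ h)
    · intro e he hec
      have key : ∀ x y : Fin N, x < y → e = {x, y} →
          ∃ x y, e = ({x, y} : Finset (Fin N)) ∧ (IsNext c x y ∨ IsNext c y x) := by
        intro x y hxy hexy
        refine ⟨x, y, hexy, ?_⟩
        have hE : EE N S x y := (EE_iff x y hxy).2 (Or.inr (hexy ▸ he))
        rcases h4 x ((mem_mp x).2 (hec (by rw [hexy]; simp))) y
          ((mem_mp y).2 (hec (by rw [hexy]; simp))) hE with h | h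
        · exact Or.inl ((next_iff _ _ _).2 (Or.inl h))
        · exact Or.inr ((next_iff _ _ _).2 (Or.inr h))
      obtain ⟨x, y, hne, hexy⟩ := Finset.card_eq_two.1 (hS.1 e he).1
      rcases lt_or_gt_of_ne hne with h | h
      · exact key x y h hexy
      · exact key y x h (by rw [hexy, Finset.pair_comm])

theorem exists_mp {N : ℕ} {S : Finset (Finset (Fin N))} (d : Finset ℕ)
    (hd : LCell (EE N S) d) : ∃ c : Finset (Fin N), mp c = d := by
  obtain ⟨x, y, hE⟩ := exists_extr hd.1
  have hy := (hd.2.2.1 _ _ hE).2.1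
  refine ⟨Finset.univ.filter (fun z : Fin N => z.val ∈ d), ?_⟩
  ext u
  simp only [mp, Finset.mem_map, Finset.mem_filter, Finset.mem_univ, true_and,
    Fin.valEmbedding_apply]
  constructor
  · rintro ⟨z, hz, rfl⟩
    exact hz
  · intro hu
    have := (hE.2.2.2 u hu).2
    exact ⟨⟨u, by omega⟩, hu, rfl⟩

theorem quid_eq {N : ℕ} {S : Finset (Finset (Fin N))} (hS : IsDissection N S) (i : Fin N) :
    quiddity N S i = qd (EE N S) 0 (N - 1) i := by
  rw [quiddity, qd]
  rw [← Set.ncard_image_of_injective (f := mp) _ (Finset.map_injective _)]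
  congr 1
  ext d
  simp only [Set.mem_image, Set.mem_ofPred_eq]
  constructor
  · rintro ⟨c, ⟨h1, h2⟩, rfl⟩
    refine ⟨(cell_iff hS c).1 h1, (mem_mp _).2 h2, fun z hz => ?_⟩
    obtain ⟨z, hzc, rfl⟩ := of_mem_mp hz
    have := z.2
    omega
  · rintro ⟨h1, h2, h3⟩
    obtain ⟨c, rfl⟩ := exists_mp d h1
    exact ⟨c, ⟨(cell_iff hS c).2 h1, (mem_mp _).1 h2⟩, rfl⟩

theorem ofFn_Pr (f : ℕ → ℕ) (n : ℕ) :
    (List.ofFn fun i : Fin n => Mmat (f i)).prod = Pr f 0 n := by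
  induction n with
  | zero => simp [Pr]
  | succ n ih =>
    rw [List.ofFn_succ_last, List.prod_append, Pr, ← ih]
    simp

/-- If `(c₁, ..., c_N)` is the quiddity of a 3-periodic dissection of a convex
`N`-gon, then `M(c₁) * M(c₂) * ... * M(c_N) = ± Id` in `SL(2, ℤ)`. -/
theorem quiddity_matrix_product (N : ℕ) (hN : 3 ≤ N)
    (S : Finset (Finset (Fin N))) (hS : IsDissection N S)
    (h3 : ∀ c : Finset (Fin N), IsCell N S c → c.card % 3 = 0) :
    (List.ofFn fun i : Fin N => Mmat (quiddity N S i)).prod = 1 ∨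
    (List.ofFn fun i : Fin N => Mmat (quiddity N S i)).prod = -1 := by
  have h := main (EE_good hS) (fun d hd => by
    obtain ⟨c, rfl⟩ := exists_mp d hd
    rw [mp, Finset.card_map]
    exact h3 c ((cell_iff hS c).2 hd)) (N - 1 - 0) 0 (N - 1) rfl
    ⟨by omega, by omega, Or.inr (Or.inl ⟨rfl, by omega⟩)⟩
  have e : (List.ofFn fun i : Fin N => Mmat (quiddity N S i)) =
      List.ofFn fun i : Fin N => Mmat (qd (EE N S) 0 (N - 1) i) := by
    congr 1
    funext i
    rw [quid_eq hS]
  rw [e, ofFn_Pr (qd (EE N S) 0 (N - 1)) N]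
  obtain ⟨k, rfl⟩ : ∃ k, N = k + 1 := ⟨N - 1, by omega⟩
  simp only [Nat.add_sub_cancel, Nat.sub_zero] at h ⊢
  rw [Pr, zero_add, Mmat_eq, ← mul_assoc]
  have hJ : Jm * Jm = -1 := by
    ext i j; fin_cases i <;> fin_cases j <;> simp [Jm]
  rcases h with h | h
  · right; rw [h, hJ]
  · left; rw [h, neg_mul, hJ, neg_neg]

end PolygonDissection
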